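/- arXiv:1807.09267 — 2 statements merged into one kernel-verified Lean document; each statement's English description precedes it below -/
import Mathlib

section
/- There exists a countable subset C of (0,π)⁴ such that for every (ω₁,ω₂,ψ₁,ψ₂) ∈ (0,π)⁴ with (ω₁,ω₂,ψ₁,ψ₂) ∉ C and every pair of natural numbers s, t: (1/(M^{s+1} N^{t+1})) Σ_{n=1}^{N} Σ_{m=1}^{M} m^s n^t cos²(ω₁ m + ω₂ m² + ψ₁ n + ψ₂ n²) → 1/(2(s+1)(t+1)) and (1/(M^{s+1} N^{t+1})) Σ_{n=1}^{N} Σ_{m=1}^{M} m^s n^t sin²(ω₁ m + ω₂ m² + ψ₁ n + ψ₂ n²) → 1/(2(s+1)(t+1)) as min{M,N} → ∞. -/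
open Filter Real

/-- Partial sums of a quasi-periodic bounded sequence with multiplier different from `1`
are bounded. -/
lemma exists_norm_sum_range_le_of_quasiperiodic {a : ℕ → ℂ} (ha : ∀ m, ‖a m‖ ≤ 1) {q : ℕ} {z : ℂ}
    (hz : z ≠ 1) (haq : ∀ m, a (m + q) = z * a m) :
    ∃ B : ℝ, ∀ N, ‖∑ m ∈ Finset.range N, a m‖ ≤ B := by
  refine ⟨2 * q / ‖z - 1‖, fun N => ?_⟩
  rw [le_div_iff₀ (norm_pos_iff.mpr (sub_ne_zero.mpr hz)), mul_comm, ← norm_mul]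
  have h1 := Finset.sum_range_add a N q
  have h2 := Finset.sum_range_add a q N
  have h3 : ∑ m ∈ Finset.range N, a (q + m) = z * ∑ m ∈ Finset.range N, a m := by
    rw [Finset.mul_sum]
    exact Finset.sum_congr rfl fun m _ => by rw [add_comm, haq]
  rw [add_comm q N, h3] at h2
  have h4 : (z - 1) * ∑ m ∈ Finset.range N, a m =
      ∑ m ∈ Finset.range q, a (N + m) - ∑ m ∈ Finset.range q, a m := by
    linear_combination h1 - h2
  have bound : ∀ f : ℕ → ℂ, (∀ m, ‖f m‖ ≤ 1) → ‖∑ m ∈ Finset.range q, f m‖ ≤ q := fun f hf => by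
    simpa using norm_sum_le_of_le (Finset.range q) fun m _ => hf m
  rw [h4]
  calc _ ≤ (q : ℝ) + q := (norm_sub_le _ _).trans
        (add_le_add (bound _ fun m => ha _) (bound _ ha))
    _ = 2 * q := by ring

lemma norm_sum_range_add_sub_le {a : ℕ → ℂ} (ha : ∀ m, ‖a m‖ ≤ 1) (N h : ℕ) :
    ‖∑ m ∈ Finset.range N, a (m + h) - ∑ m ∈ Finset.range N, a m‖ ≤ 2 * h := by
  have h1 := Finset.sum_range_add a N h
  have h2 := Finset.sum_range_add a h N
  rw [add_comm h N] at h2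
  have h3 : ∑ m ∈ Finset.range N, a (m + h) - ∑ m ∈ Finset.range N, a m =
      ∑ m ∈ Finset.range h, a (N + m) - ∑ m ∈ Finset.range h, a m := by
    simp_rw [add_comm _ h]
    linear_combination h1 - h2
  have bound : ∀ f : ℕ → ℂ, (∀ m, ‖f m‖ ≤ 1) → ‖∑ m ∈ Finset.range h, f m‖ ≤ h := fun f hf => by
    simpa using norm_sum_le_of_le (Finset.range h) fun m _ => hf m
  rw [h3]
  calc _ ≤ (h : ℝ) + h := (norm_sub_le _ _).trans
        (add_le_add (bound _ fun m => ha _) (bound _ ha))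
    _ = 2 * h := by ring

/-- If the off-diagonal correlations of a bounded sequence have bounded partial sums, then so do
the squared window sums, up to the diagonal contribution. -/
lemma exists_sum_sq_norm_window_le {a : ℕ → ℂ} (ha : ∀ m, ‖a m‖ ≤ 1)
    (hcorr : ∀ h k, h ≠ k →
      ∃ B : ℝ, ∀ N, ‖∑ m ∈ Finset.range N, a (m + h) * star (a (m + k))‖ ≤ B) (H : ℕ) :
    ∃ B : ℝ, 0 ≤ B ∧ ∀ N : ℕ,
      ∑ m ∈ Finset.range N, ‖∑ h ∈ Finset.range H, a (m + h)‖ ^ 2 ≤ N * H + B := by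
  have hcorr' : ∀ h k, ∃ B : ℝ, ∀ N : ℕ,
      ‖∑ m ∈ Finset.range N, a (m + h) * star (a (m + k))‖ ≤ (if h = k then (N : ℝ) else 0) + B := by
    intro h k
    by_cases hk : h = k
    · refine ⟨0, fun N => ?_⟩
      have := norm_sum_le_of_le (Finset.range N) (f := fun m => a (m + h) * star (a (m + k)))
        (n := fun _ => (1 : ℝ)) fun m _ => by
          rw [norm_mul, norm_star]
          exact mul_le_one₀ (ha _) (norm_nonneg _) (ha _)
      simpa [hk] using this
    · simpa [hk] using hcorr h k hk
  choose B hB using hcorr'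
  refine ⟨∑ h ∈ Finset.range H, ∑ k ∈ Finset.range H, B h k, ?_, fun N => ?_⟩
  · refine Finset.sum_nonneg fun h _ => Finset.sum_nonneg fun k _ => ?_
    simpa using hB h k 0
  have h1 : ((∑ m ∈ Finset.range N, ‖∑ h ∈ Finset.range H, a (m + h)‖ ^ 2 : ℝ) : ℂ) =
      ∑ h ∈ Finset.range H, ∑ k ∈ Finset.range H,
        ∑ m ∈ Finset.range N, a (m + h) * star (a (m + k)) := by
    push_cast
    rw [Finset.sum_congr rfl fun h _ => Finset.sum_comm, Finset.sum_comm]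
    refine Finset.sum_congr rfl fun m _ => ?_
    rw [← Complex.mul_conj', map_sum, Finset.sum_mul_sum]
    rfl
  calc _ ≤ ‖((∑ m ∈ Finset.range N, ‖∑ h ∈ Finset.range H, a (m + h)‖ ^ 2 : ℝ) : ℂ)‖ := by
        rw [Complex.norm_real]; exact le_abs_self _
    _ ≤ ∑ h ∈ Finset.range H, ∑ k ∈ Finset.range H, ((if h = k then (N : ℝ) else 0) + B h k) := by
        rw [h1]
        exact norm_sum_le_of_le _ fun h _ => norm_sum_le_of_le _ fun k _ => hB h k N
    _ = _ := by
        simp only [Finset.sum_add_distrib, Finset.sum_ite_eq, add_left_inj]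
        rw [Finset.sum_congr rfl fun h hh => if_pos hh]
        simp [mul_comm]

/-- A form of van der Corput's difference theorem. -/
lemma isLittleO_sum_range_of_correlations_bounded {a : ℕ → ℂ} (ha : ∀ m, ‖a m‖ ≤ 1)
    (hcorr : ∀ h k, h ≠ k →
      ∃ B : ℝ, ∀ N, ‖∑ m ∈ Finset.range N, a (m + h) * star (a (m + k))‖ ≤ B) :
    (fun N : ℕ => ∑ m ∈ Finset.range N, a m) =o[atTop] (fun N : ℕ => (N : ℝ)) := by
  rw [Asymptotics.isLittleO_iff]
  intro ε hε
  obtain ⟨H, hH⟩ := exists_nat_gt (4 / ε ^ 2)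
  have hH0 : (0 : ℝ) < H := lt_trans (by positivity) hH
  have hH1 : (1 : ℝ) ≤ H := by exact_mod_cast Nat.cast_pos.mp hH0
  obtain ⟨B, hB0, hB⟩ := exists_sum_sq_norm_window_le ha hcorr H
  obtain ⟨K, hK⟩ := exists_nat_gt ((8 * H ^ 2 + 2 * B) * 2 / ε ^ 2)
  filter_upwards [eventually_ge_atTop (max K 1)] with N hN
  have hN1 : (1 : ℝ) ≤ N := by exact_mod_cast (le_max_right K 1).trans hN
  have hNK : (K : ℝ) ≤ N := by exact_mod_cast (le_max_left K 1).trans hN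
  set S := ∑ m ∈ Finset.range N, a m with hS
  set W := ∑ m ∈ Finset.range N, ∑ h ∈ Finset.range H, a (m + h) with hW
  have hdiff : ‖W - H * S‖ ≤ 2 * H ^ 2 := by
    have : W - H * S = ∑ h ∈ Finset.range H, (∑ m ∈ Finset.range N, a (m + h) - S) := by
      rw [hW, Finset.sum_comm, Finset.sum_sub_distrib]
      simp
    rw [this]
    calc _ ≤ ∑ h ∈ Finset.range H, (2 * H : ℝ) := norm_sum_le_of_le _ fun h hh =>
          (norm_sum_range_add_sub_le ha N h).trans (by
            have : (h : ℝ) ≤ H := by exact_mod_cast (Finset.mem_range.mp hh).le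
            linarith)
      _ = _ := by simp; ring
  have hWsq : ‖W‖ ^ 2 ≤ N * (N * H + B) := by
    calc ‖W‖ ^ 2 ≤ (∑ m ∈ Finset.range N, ‖∑ h ∈ Finset.range H, a (m + h)‖) ^ 2 := by
          gcongr; exact norm_sum_le _ _
      _ ≤ N * ∑ m ∈ Finset.range N, ‖∑ h ∈ Finset.range H, a (m + h)‖ ^ 2 := by
          simpa using sq_sum_le_card_mul_sum_sq (s := Finset.range N)
            (f := fun m => ‖∑ h ∈ Finset.range H, a (m + h)‖)
      _ ≤ _ := by gcongr; exact hB N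
  have hHS : H * ‖S‖ ≤ 2 * H ^ 2 + ‖W‖ := by
    have : (H : ℂ) * S = W - (W - H * S) := by ring
    calc (H : ℝ) * ‖S‖ = ‖(H : ℂ) * S‖ := by simp
      _ ≤ ‖W‖ + ‖W - H * S‖ := by
          conv_lhs => rw [this]
          exact norm_sub_le _ _
      _ ≤ _ := by linarith
  have hsq : H ^ 2 * ‖S‖ ^ 2 ≤ 8 * H ^ 4 + 2 * (N * (N * H + B)) := by
    have : (H * ‖S‖) ^ 2 ≤ (2 * H ^ 2 + ‖W‖) ^ 2 := by gcongr
    nlinarith [sq_nonneg (2 * (H : ℝ) ^ 2 - ‖W‖)]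
  rw [div_lt_iff₀ (by positivity)] at hH hK
  have hmain : (H : ℝ) ^ 2 * ‖S‖ ^ 2 ≤ H ^ 2 * (ε * N) ^ 2 := by
    refine hsq.trans ?_
    have e1 : 4 * (H * (N : ℝ) ^ 2) ≤ (H * ε ^ 2) * (H * N ^ 2) := by gcongr
    have e2 : (8 * H ^ 2 + 2 * B) * 2 * (N * (H : ℝ) ^ 2) ≤ (N * ε ^ 2) * (N * H ^ 2) := by
      exact mul_le_mul_of_nonneg_right (hK.le.trans (by gcongr)) (by positivity)
    have e3 : 8 * (H : ℝ) ^ 4 * 1 ≤ 8 * H ^ 4 * N := by gcongr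
    have e4 : 2 * B * N * 1 ≤ 2 * B * N * (H : ℝ) ^ 2 := by
      gcongr
      exact one_le_pow₀ hH1
    nlinarith
  have := le_of_mul_le_mul_left hmain (by positivity)
  simpa using (pow_le_pow_iff_left₀ (norm_nonneg _) (by positivity) two_ne_zero).mp this

/-- Exponential sums of a quadratic phase with at least one coefficient that is not a rational
multiple of `π`. -/
lemma isLittleO_sum_exp_quadratic {α β : ℝ}
    (h : ¬ ∃ x y : ℚ, α = x * π ∧ β = y * π) :
    (fun N : ℕ => ∑ m ∈ Finset.range N,
      Complex.exp (((2 * (α * m + β * m ^ 2) : ℝ) : ℂ) * Complex.I)) =o[atTop]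
        (fun N : ℕ => (N : ℝ)) := by
  have ha : ∀ m : ℕ, ‖Complex.exp (((2 * (α * m + β * m ^ 2) : ℝ) : ℂ) * Complex.I)‖ ≤ 1 :=
    fun m => (Complex.norm_exp_ofReal_mul_I _).le
  have hπ : (π : ℂ) ≠ 0 := by exact_mod_cast pi_ne_zero
  by_cases hβ : ∃ y : ℚ, β = y * π
  · obtain ⟨y, rfl⟩ := hβ
    have hq : (y.den : ℝ) ≠ 0 := by exact_mod_cast y.den_nz
    have hy : (y : ℝ) * y.den = y.num := by exact_mod_cast Rat.mul_den_eq_num y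
    obtain ⟨B, hB⟩ := exists_norm_sum_range_le_of_quasiperiodic ha (q := y.den)
      (z := Complex.exp (((2 * α * y.den : ℝ) : ℂ) * Complex.I)) (by
        rw [Ne, Complex.exp_eq_one_iff]
        rintro ⟨n, hn⟩
        refine h ⟨n / y.den, y, ?_, rfl⟩
        have h1 : ((2 * α * y.den : ℝ) : ℂ) = ((n * (2 * π) : ℝ) : ℂ) := by
          apply mul_right_cancel₀ Complex.I_ne_zero
          rw [hn]; push_cast; ring
        have h2 := Complex.ofReal_injective h1
        push_cast
        field_simp
        linarith) (by
        intro m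
        rw [← Complex.exp_add, Complex.exp_eq_exp_iff_exists_int]
        refine ⟨y.num * (2 * m + y.den), ?_⟩
        have hy' : (y : ℂ) * y.den = y.num := by exact_mod_cast Rat.mul_den_eq_num y
        push_cast
        rw [← hy']
        ring)
    refine Asymptotics.IsBigO.trans_isLittleO (g := fun _ => (1 : ℝ))
      (Asymptotics.IsBigO.of_bound B (Eventually.of_forall fun N => by simpa using hB N)) ?_
    rw [Asymptotics.isLittleO_const_left]
    right
    simpa [Function.comp_def] using tendsto_natCast_atTop_atTop (R := ℝ)
  · refine isLittleO_sum_range_of_correlations_bounded ha fun k l hkl => ?_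
    have hkl' : (k : ℝ) - l ≠ 0 := sub_ne_zero.mpr (by exact_mod_cast hkl)
    refine exists_norm_sum_range_le_of_quasiperiodic (q := 1)
      (z := Complex.exp (((4 * β * (k - l) : ℝ) : ℂ) * Complex.I)) (fun m => ?_) ?_ fun m => ?_
    · rw [norm_mul, norm_star]
      exact mul_le_one₀ (Complex.norm_exp_ofReal_mul_I _).le (norm_nonneg _)
        (Complex.norm_exp_ofReal_mul_I _).le
    · rw [Ne, Complex.exp_eq_one_iff]
      rintro ⟨n, hn⟩
      refine hβ ⟨n / (2 * (k - l)), ?_⟩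
      have h1 : ((4 * β * (k - l) : ℝ) : ℂ) = ((n * (2 * π) : ℝ) : ℂ) := by
        apply mul_right_cancel₀ Complex.I_ne_zero
        rw [hn]; push_cast; ring
      have h2 := Complex.ofReal_injective h1
      push_cast
      field_simp
      linarith
    · simp only [Complex.star_def, ← Complex.exp_conj, map_mul, Complex.conj_ofReal,
        Complex.conj_I, ← Complex.exp_add]
      congr 1
      push_cast
      ring

/-- Summation by parts: polynomial weights preserve `o`-bounds on partial sums. -/
lemma isLittleO_sum_range_pow_mul {a : ℕ → ℂ}
    (ha : (fun N : ℕ => ∑ m ∈ Finset.range N, a m) =o[atTop] (fun N : ℕ => (N : ℝ))) (s : ℕ) :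
    (fun N : ℕ => ∑ m ∈ Finset.range N, (m : ℂ) ^ s * a m) =o[atTop]
      (fun N : ℕ => (N : ℝ) ^ (s + 1)) := by
  induction s with
  | zero => simpa using ha
  | succ s ih =>
    set T : ℕ → ℂ := fun N => ∑ m ∈ Finset.range N, (m : ℂ) ^ s * a m with hT
    have hparts : ∀ N : ℕ, ∑ m ∈ Finset.range N, (m : ℂ) ^ (s + 1) * a m =
        N * T N - ∑ k ∈ Finset.range N, T (k + 1) := by
      intro N
      induction N with
      | zero => simp
      | succ N ih =>
        rw [Finset.sum_range_succ, ih, Finset.sum_range_succ]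
        have : T (N + 1) = T N + (N : ℂ) ^ s * a N := Finset.sum_range_succ _ _
        rw [this]
        push_cast
        ring
    simp_rw [hparts]
    refine Asymptotics.IsLittleO.sub ?_ ?_
    · have : (fun N : ℕ => (N : ℂ)) =O[atTop] (fun N : ℕ => (N : ℝ)) :=
        Asymptotics.IsBigO.of_bound 1 (Eventually.of_forall fun N => by simp)
      refine (this.mul_isLittleO ih).congr_right fun N => by ring
    · have hshift : (fun k => T (k + 1)) =o[atTop] (fun k : ℕ => ((k + 1 : ℕ) : ℝ) ^ (s + 1)) :=
        ih.comp_tendsto (tendsto_add_atTop_nat 1)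
      have hle : ∀ N : ℕ, (N : ℝ) ≤ ∑ k ∈ Finset.range N, ((k + 1 : ℕ) : ℝ) ^ (s + 1) := by
        intro N
        calc (N : ℝ) = ∑ k ∈ Finset.range N, (1 : ℝ) := by simp
          _ ≤ _ := by
            gcongr with k
            exact one_le_pow₀ (by push_cast; linarith [(k.cast_nonneg : (0 : ℝ) ≤ k)])
      refine (hshift.sum_range (fun k => by positivity)
        (tendsto_atTop_mono hle tendsto_natCast_atTop_atTop)).trans_isBigO ?_
      refine Asymptotics.IsBigO.of_bound 1 (Eventually.of_forall fun N => ?_)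
      rw [one_mul, Real.norm_of_nonneg (by positivity), Real.norm_of_nonneg (by positivity)]
      calc _ ≤ ∑ k ∈ Finset.range N, (N : ℝ) ^ (s + 1) := by
            gcongr with k hk
            exact Finset.mem_range.mp hk
        _ = _ := by simp; ring

lemma tendsto_weighted_sum_exp_quadratic {α β : ℝ}
    (h : ¬ ∃ x y : ℚ, α = x * π ∧ β = y * π) (s : ℕ) :
    Tendsto (fun N : ℕ => (1 / (N : ℂ) ^ (s + 1)) * ∑ m ∈ Finset.Icc 1 N,
      (m : ℂ) ^ s * Complex.exp (((2 * (α * m + β * m ^ 2) : ℝ) : ℂ) * Complex.I))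
      atTop (nhds 0) := by
  set a : ℕ → ℂ := fun m => Complex.exp (((2 * (α * m + β * m ^ 2) : ℝ) : ℂ) * Complex.I) with ha
  have hshift : (fun N : ℕ => ∑ m ∈ Finset.range (N + 1), (m : ℂ) ^ s * a m) =o[atTop]
      (fun N : ℕ => (N : ℝ) ^ (s + 1)) := by
    refine ((isLittleO_sum_range_pow_mul (isLittleO_sum_exp_quadratic h) s).comp_tendsto
      (tendsto_add_atTop_nat 1)).trans_isBigO ?_
    refine Asymptotics.IsBigO.pow ?_ _
    refine Asymptotics.IsBigO.of_bound 2 ?_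
    filter_upwards [eventually_ge_atTop 1] with N hN
    have : (1 : ℝ) ≤ N := by exact_mod_cast hN
    simp only [Nat.cast_add, Nat.cast_one]
    rw [Real.norm_of_nonneg (by positivity), Real.norm_of_nonneg (by positivity)]
    linarith
  have hzero : (fun _ : ℕ => (0 : ℂ) ^ s * a 0) =o[atTop] (fun N : ℕ => (N : ℝ) ^ (s + 1)) := by
    rw [Asymptotics.isLittleO_const_left]
    right
    have := (tendsto_pow_atTop (α := ℝ) (Nat.succ_ne_zero s)).comp tendsto_natCast_atTop_atTop
    exact tendsto_norm_atTop_atTop.comp this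
  have hfin := (hshift.sub hzero).congr_left (f₂ := fun N : ℕ => ∑ m ∈ Finset.Icc 1 N,
      (m : ℂ) ^ s * a m) fun N => by
    rw [Finset.range_eq_Ico, Finset.sum_eq_sum_Ico_succ_bot (Nat.succ_pos N)]
    simp only [Nat.cast_zero, add_sub_cancel_left]
    rfl
  have := hfin.norm_left.tendsto_div_nhds_zero
  rw [tendsto_zero_iff_norm_tendsto_zero]
  refine this.congr fun N => ?_
  rw [norm_mul, norm_div, norm_pow, Complex.norm_natCast]
  simp only [norm_one]
  ring

lemma succ_mul_pow_le_succ_pow_sub (x : ℝ) (hx : 0 ≤ x) (s : ℕ) :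
    (s + 1) * x ^ s ≤ (x + 1) ^ (s + 1) - x ^ (s + 1) ∧
      (x + 1) ^ (s + 1) - x ^ (s + 1) ≤ (s + 1) * (x + 1) ^ s := by
  have hgeom := (Commute.all (x + 1) x).geom_sum₂_mul (s + 1)
  rw [add_sub_cancel_left, mul_one] at hgeom
  rw [← hgeom]
  have hmem : ∀ i ∈ Finset.range (s + 1), i + (s - i) = s := fun i hi => by
    have := Finset.mem_range.mp hi
    omega
  constructor
  · calc ((s : ℝ) + 1) * x ^ s = ∑ i ∈ Finset.range (s + 1), x ^ s := by simp
      _ ≤ _ := by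
        refine Finset.sum_le_sum fun i hi => ?_
        conv_lhs => rw [← hmem i hi, pow_add]
        simp only [add_tsub_cancel_right]
        gcongr
        linarith
  · calc _ ≤ ∑ i ∈ Finset.range (s + 1), (x + 1) ^ s := by
          refine Finset.sum_le_sum fun i hi => ?_
          conv_rhs => rw [← hmem i hi, pow_add]
          simp only [add_tsub_cancel_right]
          gcongr
          linarith
      _ = _ := by simp

lemma tendsto_sum_Icc_pow_div_pow (s : ℕ) :
    Tendsto (fun N : ℕ => (1 / (N : ℝ) ^ (s + 1)) * ∑ m ∈ Finset.Icc 1 N, (m : ℝ) ^ s)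
      atTop (nhds (1 / ((s : ℝ) + 1))) := by
  have hs : (0 : ℝ) < s + 1 := by positivity
  have hlow : ∀ N : ℕ, (N : ℝ) ^ (s + 1) ≤ (s + 1) * ∑ m ∈ Finset.Icc 1 N, (m : ℝ) ^ s := by
    intro N
    induction N with
    | zero => simp
    | succ N ih =>
      rw [Finset.sum_Icc_succ_top (by omega)]
      have := (succ_mul_pow_le_succ_pow_sub N N.cast_nonneg s).2
      push_cast
      linarith
  have hupp : ∀ N : ℕ, (s + 1) * ∑ m ∈ Finset.Icc 1 N, (m : ℝ) ^ s ≤ ((N : ℝ) + 1) ^ (s + 1) := by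
    intro N
    induction N with
    | zero => simp
    | succ N ih =>
      rw [Finset.sum_Icc_succ_top (by omega)]
      have := (succ_mul_pow_le_succ_pow_sub (N + 1) (by positivity) s).1
      push_cast
      linarith
  have hlim : Tendsto (fun N : ℕ => 1 / ((s : ℝ) + 1) * (1 + 1 / (N : ℝ)) ^ (s + 1)) atTop
      (nhds (1 / ((s : ℝ) + 1))) := by
    simpa using ((tendsto_one_div_atTop_nhds_zero_nat (𝕜 := ℝ)).const_add 1 |>.pow (s + 1)).const_mul
      (1 / ((s : ℝ) + 1))
  refine tendsto_of_tendsto_of_tendsto_of_le_of_le' tendsto_const_nhds hlim ?_ ?_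
  · filter_upwards [eventually_ge_atTop 1] with N hN
    have hN0 : (0 : ℝ) < N := by exact_mod_cast hN
    rw [div_mul_eq_mul_div, one_mul, div_le_div_iff₀ hs (by positivity)]
    linarith [hlow N]
  · filter_upwards [eventually_ge_atTop 1] with N hN
    have hN0 : (0 : ℝ) < N := by exact_mod_cast hN
    have : (1 + 1 / (N : ℝ)) ^ (s + 1) = ((N : ℝ) + 1) ^ (s + 1) / (N : ℝ) ^ (s + 1) := by
      rw [← div_pow]
      congr 1
      field_simp
    rw [this, div_mul_div_comm, div_mul_eq_mul_div, one_mul, one_mul,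
      div_le_div_iff₀ (by positivity) (by positivity)]
    nlinarith [mul_le_mul_of_nonneg_right (hupp N) (by positivity : (0 : ℝ) ≤ (N : ℝ) ^ (s + 1))]

lemma norm_weighted_sum_exp_le (θ : ℕ → ℝ) (s N : ℕ) :
    ‖(1 / (N : ℂ) ^ (s + 1)) * ∑ m ∈ Finset.Icc 1 N,
      (m : ℂ) ^ s * Complex.exp ((θ m : ℂ) * Complex.I)‖ ≤
      (1 / (N : ℝ) ^ (s + 1)) * ∑ m ∈ Finset.Icc 1 N, (m : ℝ) ^ s := by
  rw [norm_mul, norm_div, norm_pow, Complex.norm_natCast, norm_one]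
  gcongr
  refine norm_sum_le_of_le _ fun m _ => ?_
  rw [norm_mul, Complex.norm_exp_ofReal_mul_I, norm_pow, Complex.norm_natCast, mul_one]

lemma tendsto_prod_weighted_sums {ω₁ ω₂ ψ₁ ψ₂ : ℝ}
    (h : (¬ ∃ x y : ℚ, ω₁ = x * π ∧ ω₂ = y * π) ∨ ¬ ∃ x y : ℚ, ψ₁ = x * π ∧ ψ₂ = y * π)
    (s t : ℕ) :
    Tendsto (fun MN : ℕ × ℕ =>
      ((1 / (MN.1 : ℂ) ^ (s + 1)) * ∑ m ∈ Finset.Icc 1 MN.1,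
        (m : ℂ) ^ s * Complex.exp (((2 * (ω₁ * m + ω₂ * m ^ 2) : ℝ) : ℂ) * Complex.I)) *
      ((1 / (MN.2 : ℂ) ^ (t + 1)) * ∑ n ∈ Finset.Icc 1 MN.2,
        (n : ℂ) ^ t * Complex.exp (((2 * (ψ₁ * n + ψ₂ * n ^ 2) : ℝ) : ℂ) * Complex.I)))
      atTop (nhds 0) := by
  rw [← prod_atTop_atTop_eq]
  rcases h with h | h
  · refine squeeze_zero_norm (fun MN => (norm_mul_le _ _).trans
      (mul_le_mul_of_nonneg_left (norm_weighted_sum_exp_le _ t MN.2) (norm_nonneg _))) ?_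
    simpa using ((tendsto_weighted_sum_exp_quadratic h s).norm.comp tendsto_fst).mul
      ((tendsto_sum_Icc_pow_div_pow t).comp tendsto_snd)
  · refine squeeze_zero_norm (fun MN => (norm_mul_le _ _).trans
      (mul_le_mul_of_nonneg_right (norm_weighted_sum_exp_le _ s MN.1) (norm_nonneg _))) ?_
    simpa using ((tendsto_sum_Icc_pow_div_pow s).comp tendsto_fst).mul
      ((tendsto_weighted_sum_exp_quadratic h t).norm.comp tendsto_snd)

lemma weighted_sum_cos_eq_re (ω₁ ω₂ ψ₁ ψ₂ : ℝ) (s t M N : ℕ) :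
    (1 / ((M : ℝ) ^ (s + 1) * (N : ℝ) ^ (t + 1))) *
      ∑ n ∈ Finset.Icc 1 N, ∑ m ∈ Finset.Icc 1 M, (m : ℝ) ^ s * (n : ℝ) ^ t *
        cos (2 * (ω₁ * (m : ℝ) + ω₂ * (m : ℝ) ^ 2 + ψ₁ * (n : ℝ) + ψ₂ * (n : ℝ) ^ 2)) =
    (((1 / (M : ℂ) ^ (s + 1)) * ∑ m ∈ Finset.Icc 1 M,
        (m : ℂ) ^ s * Complex.exp (((2 * (ω₁ * m + ω₂ * m ^ 2) : ℝ) : ℂ) * Complex.I)) *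
      ((1 / (N : ℂ) ^ (t + 1)) * ∑ n ∈ Finset.Icc 1 N,
        (n : ℂ) ^ t * Complex.exp (((2 * (ψ₁ * n + ψ₂ * n ^ 2) : ℝ) : ℂ) * Complex.I))).re := by
  rw [mul_mul_mul_comm, Finset.sum_mul_sum, Finset.sum_comm]
  have hc : (1 / (M : ℂ) ^ (s + 1)) * (1 / (N : ℂ) ^ (t + 1)) =
      ((1 / ((M : ℝ) ^ (s + 1) * (N : ℝ) ^ (t + 1)) : ℝ) : ℂ) := by
    push_cast
    rw [div_mul_div_comm, one_mul]
  rw [hc, Complex.re_ofReal_mul, Complex.re_sum]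
  simp_rw [Complex.re_sum]
  congr 1
  refine Finset.sum_congr rfl fun m _ => Finset.sum_congr rfl fun n _ => ?_
  rw [mul_mul_mul_comm, ← Complex.exp_add, ← add_mul, ← Complex.ofReal_add]
  have hw : (m : ℂ) ^ s * (n : ℂ) ^ t = (((m : ℝ) ^ s * (n : ℝ) ^ t : ℝ) : ℂ) := by push_cast; rfl
  rw [hw, Complex.re_ofReal_mul, Complex.exp_ofReal_mul_I_re]
  congr 2
  ring

lemma weighted_sum_one_eq_mul (s t M N : ℕ) :
    (1 / ((M : ℝ) ^ (s + 1) * (N : ℝ) ^ (t + 1))) *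
      ∑ n ∈ Finset.Icc 1 N, ∑ m ∈ Finset.Icc 1 M, (m : ℝ) ^ s * (n : ℝ) ^ t =
    ((1 / (M : ℝ) ^ (s + 1)) * ∑ m ∈ Finset.Icc 1 M, (m : ℝ) ^ s) *
      ((1 / (N : ℝ) ^ (t + 1)) * ∑ n ∈ Finset.Icc 1 N, (n : ℝ) ^ t) := by
  rw [mul_mul_mul_comm, Finset.sum_mul_sum, Finset.sum_comm, div_mul_div_comm, one_mul]


/-- There exists a countable subset `C` of `(0,π)⁴` such that for every
`(ω₁,ω₂,ψ₁,ψ₂) ∈ (0,π)⁴` outside `C` and all naturals `s, t`: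
`(1/(M^{s+1} N^{t+1})) Σ_{n=1}^{N} Σ_{m=1}^{M} m^s n^t cos²(ω₁ m + ω₂ m² + ψ₁ n + ψ₂ n²)
  → 1/(2(s+1)(t+1))` and similarly with `sin²`, as `min{M,N} → ∞`. -/
theorem stmt3 :
    ∃ C : Set (ℝ × ℝ × ℝ × ℝ), C.Countable ∧
      ∀ ω₁ ω₂ ψ₁ ψ₂ : ℝ, ω₁ ∈ Set.Ioo 0 π → ω₂ ∈ Set.Ioo 0 π →
        ψ₁ ∈ Set.Ioo 0 π → ψ₂ ∈ Set.Ioo 0 π → (ω₁, ω₂, ψ₁, ψ₂) ∉ C → ∀ s t : ℕ,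
        Tendsto (fun MN : ℕ × ℕ =>
            (1 / ((MN.1 : ℝ) ^ (s + 1) * (MN.2 : ℝ) ^ (t + 1))) *
              ∑ n ∈ Finset.Icc 1 MN.2, ∑ m ∈ Finset.Icc 1 MN.1,
                (m : ℝ) ^ s * (n : ℝ) ^ t *
                  Real.cos (ω₁ * (m : ℝ) + ω₂ * (m : ℝ) ^ 2 + ψ₁ * (n : ℝ) + ψ₂ * (n : ℝ) ^ 2) ^ 2)
          atTop (nhds (1 / (2 * ((s : ℝ) + 1) * ((t : ℝ) + 1)))) ∧
        Tendsto (fun MN : ℕ × ℕ =>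
            (1 / ((MN.1 : ℝ) ^ (s + 1) * (MN.2 : ℝ) ^ (t + 1))) *
              ∑ n ∈ Finset.Icc 1 MN.2, ∑ m ∈ Finset.Icc 1 MN.1,
                (m : ℝ) ^ s * (n : ℝ) ^ t *
                  Real.sin (ω₁ * (m : ℝ) + ω₂ * (m : ℝ) ^ 2 + ψ₁ * (n : ℝ) + ψ₂ * (n : ℝ) ^ 2) ^ 2)
          atTop (nhds (1 / (2 * ((s : ℝ) + 1) * ((t : ℝ) + 1)))) := by
  refine ⟨Set.range fun x : ℚ × ℚ × ℚ × ℚ => (x.1 * π, x.2.1 * π, x.2.2.1 * π, x.2.2.2 * π),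
    Set.countable_range _, fun ω₁ ω₂ ψ₁ ψ₂ _ _ _ _ hC s t => ?_⟩
  have h : (¬ ∃ x y : ℚ, ω₁ = x * π ∧ ω₂ = y * π) ∨ ¬ ∃ x y : ℚ, ψ₁ = x * π ∧ ψ₂ = y * π := by
    by_contra! hcon
    obtain ⟨⟨x, y, rfl, rfl⟩, z, w, rfl, rfl⟩ := hcon
    exact hC ⟨(x, y, z, w), rfl⟩
  have hosc := (Complex.continuous_re.tendsto 0).comp (tendsto_prod_weighted_sums h s t)
  have hone : Tendsto (fun MN : ℕ × ℕ => (1 / ((MN.1 : ℝ) ^ (s + 1) * (MN.2 : ℝ) ^ (t + 1))) *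
      ∑ n ∈ Finset.Icc 1 MN.2, ∑ m ∈ Finset.Icc 1 MN.1, (m : ℝ) ^ s * (n : ℝ) ^ t) atTop
      (nhds (1 / ((s : ℝ) + 1) * (1 / ((t : ℝ) + 1)))) := by
    simp_rw [weighted_sum_one_eq_mul]
    rw [← prod_atTop_atTop_eq]
    exact ((tendsto_sum_Icc_pow_div_pow s).comp tendsto_fst).mul
      ((tendsto_sum_Icc_pow_div_pow t).comp tendsto_snd)
  have hval : 1 / (2 * ((s : ℝ) + 1) * ((t : ℝ) + 1)) =
      1 / ((s : ℝ) + 1) * (1 / ((t : ℝ) + 1)) / 2 := by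
    field_simp
  rw [hval]
  constructor
  · have := (hone.add hosc).div_const 2
    rw [Complex.zero_re, add_zero] at this
    refine this.congr fun MN => ?_
    rw [Function.comp_apply, ← weighted_sum_cos_eq_re, ← mul_add, mul_div_assoc,
      ← Finset.sum_add_distrib, Finset.sum_div]
    congr 1
    refine Finset.sum_congr rfl fun n _ => ?_
    rw [← Finset.sum_add_distrib, Finset.sum_div]
    refine Finset.sum_congr rfl fun m _ => ?_
    rw [cos_sq]
    ring
  · have := (hone.sub hosc).div_const 2
    rw [Complex.zero_re, sub_zero] at this
    refine this.congr fun MN => ?_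
    rw [Function.comp_apply, ← weighted_sum_cos_eq_re, ← mul_sub, mul_div_assoc,
      ← Finset.sum_sub_distrib, Finset.sum_div]
    congr 1
    refine Finset.sum_congr rfl fun n _ => ?_
    rw [← Finset.sum_sub_distrib, Finset.sum_div]
    refine Finset.sum_congr rfl fun m _ => ?_
    rw [sin_sq_eq_half_sub]
    ring
end

section
/- There exists a countable subset C of (0,π)⁴ such that for every ϑ = (α,β,γ,δ) ∈ (0,π)⁴ with ϑ ∉ C, the 2×2 matrix (1/(MN)) W(ϑ)ᵀ W(ϑ) converges, as min{M,N} → ∞, to the matrix [[1/2, 0],[0, 1/2]]; equivalently, (1/(MN)) Σ_{n=1}^{N} Σ_{m=1}^{M} cos²(α m + β m² + γ n + δ n²) → 1/2, (1/(MN)) Σ_{n=1}^{N} Σ_{m=1}^{M} sin²(α m + β m² + γ n + δ n²) → 1/2, and (1/(MN)) Σ_{n=1}^{N} Σ_{m=1}^{M} cos(α m + β m² + γ n + δ n²) sin(α m + β m² + γ n + δ n²) → 0. -/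
open Filter Real Matrix

/-- Shifting the summation range of a bounded sequence changes the sum by a bounded amount. -/
theorem norm_sum_range_shift_sub_le (f : ℕ → ℂ) (hf : ∀ m, ‖f m‖ ≤ 1) (q N : ℕ) :
    ‖∑ m ∈ Finset.range N, f (m + q) - ∑ m ∈ Finset.range N, f m‖ ≤ 2 * q := by
  have h1 := Finset.sum_range_add f q N
  have h2 := Finset.sum_range_add f N q
  rw [add_comm N q] at h2
  have h3 : ∑ m ∈ Finset.range N, f (m + q) - ∑ m ∈ Finset.range N, f m
      = ∑ m ∈ Finset.range q, f (N + m) - ∑ m ∈ Finset.range q, f m := by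
    simp only [add_comm _ q]
    linear_combination h2 - h1
  have key : ∀ g : ℕ → ℂ, (∀ m, ‖g m‖ ≤ 1) → ‖∑ m ∈ Finset.range q, g m‖ ≤ q := by
    intro g hg
    simpa using norm_sum_le_of_le (Finset.range q) (fun m _ => hg m)
  rw [h3]
  calc _ ≤ ‖∑ m ∈ Finset.range q, f (N + m)‖ + ‖∑ m ∈ Finset.range q, f m‖ := norm_sub_le _ _
    _ ≤ q + q := add_le_add (key _ fun m => hf _) (key _ hf)
    _ = 2 * q := by ring

/-- Partial sums of a bounded sequence that is multiplied by `z ≠ 1` under a shift are bounded. -/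
theorem norm_sum_range_le_of_shift_eq_mul (f : ℕ → ℂ) (hf : ∀ m, ‖f m‖ ≤ 1) (q : ℕ) (z : ℂ)
    (hz : z ≠ 1) (h : ∀ m, f (m + q) = z * f m) (N : ℕ) :
    ‖∑ m ∈ Finset.range N, f m‖ ≤ 2 * q / ‖z - 1‖ := by
  have hpos : 0 < ‖z - 1‖ := norm_pos_iff.2 (sub_ne_zero.2 hz)
  rw [le_div_iff₀ hpos, ← norm_mul]
  have key := norm_sum_range_shift_sub_le f hf q N
  simp only [h, ← Finset.mul_sum] at key
  rwa [← sub_one_mul, mul_comm] at key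

/-- A finite form of van der Corput's inequality. -/
theorem sq_norm_sum_range_le (f : ℕ → ℂ) (hf : ∀ m, ‖f m‖ ≤ 1) (K : ℕ → ℕ → ℝ)
    (hK : ∀ h k, h ≠ k → ∀ N,
      ‖∑ m ∈ Finset.range N, f (m + h) * (starRingEnd ℂ) (f (m + k))‖ ≤ K h k) (H N : ℕ) :
    (H * ‖∑ m ∈ Finset.range N, f m‖) ^ 2 ≤ 8 * (H : ℝ) ^ 4 + 2 * (N * (H * N +
      ∑ h ∈ Finset.range H, ∑ k ∈ Finset.range H, |K h k|)) := by
  set S := ∑ m ∈ Finset.range N, f m with hS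
  set T := ∑ m ∈ Finset.range N, ∑ h ∈ Finset.range H, f (m + h) with hT
  have hST : ‖T - H * S‖ ≤ 2 * (H : ℝ) ^ 2 := by
    have : T - H * S = ∑ h ∈ Finset.range H,
        (∑ m ∈ Finset.range N, f (m + h) - ∑ m ∈ Finset.range N, f m) := by
      rw [hT, Finset.sum_comm, Finset.sum_sub_distrib]
      simp [hS]
    rw [this]
    have := norm_sum_le_of_le (Finset.range H) (f := fun h =>
        (∑ m ∈ Finset.range N, f (m + h) - ∑ m ∈ Finset.range N, f m)) (n := fun _ => 2 * (H : ℝ))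
      (fun h hh => (norm_sum_range_shift_sub_le f hf h N).trans (by
        have : (h : ℝ) ≤ H := by exact_mod_cast (Finset.mem_range.1 hh).le
        linarith))
    refine this.trans (le_of_eq ?_)
    simp
    ring
  have hsq : ((∑ m ∈ Finset.range N, ‖∑ h ∈ Finset.range H, f (m + h)‖ ^ 2 : ℝ) : ℂ)
      = ∑ h ∈ Finset.range H, ∑ k ∈ Finset.range H, ∑ m ∈ Finset.range N,
        f (m + h) * (starRingEnd ℂ) (f (m + k)) := by
    push_cast
    simp only [← Complex.mul_conj', map_sum, Finset.sum_mul_sum]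
    rw [Finset.sum_comm]
    exact Finset.sum_congr rfl fun h _ => Finset.sum_comm
  have hQ : ∑ m ∈ Finset.range N, ‖∑ h ∈ Finset.range H, f (m + h)‖ ^ 2
      ≤ H * N + ∑ h ∈ Finset.range H, ∑ k ∈ Finset.range H, |K h k| := by
    have h0 : 0 ≤ ∑ m ∈ Finset.range N, ‖∑ h ∈ Finset.range H, f (m + h)‖ ^ 2 :=
      Finset.sum_nonneg fun _ _ => sq_nonneg _
    rw [← abs_of_nonneg h0, ← Real.norm_eq_abs, ← Complex.norm_real, hsq]
    have hb : ∀ h ∈ Finset.range H, ‖∑ k ∈ Finset.range H, ∑ m ∈ Finset.range N,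
        f (m + h) * (starRingEnd ℂ) (f (m + k))‖ ≤ N + ∑ k ∈ Finset.range H, |K h k| := by
      intro h hh
      have hc : ∀ k ∈ Finset.range H, ‖∑ m ∈ Finset.range N,
          f (m + h) * (starRingEnd ℂ) (f (m + k))‖ ≤ (if h = k then (N : ℝ) else 0) + |K h k| := by
        intro k _
        by_cases hk : h = k
        · have := norm_sum_le_of_le (Finset.range N)
            (f := fun m => f (m + h) * (starRingEnd ℂ) (f (m + k))) (n := fun _ => (1 : ℝ))
            (fun m _ => by
              rw [norm_mul, RCLike.norm_conj]
              exact mul_le_one₀ (hf _) (norm_nonneg _) (hf _))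
          have h2 := abs_nonneg (K h k)
          simp only [Finset.sum_const, Finset.card_range, nsmul_eq_mul, mul_one] at this
          rw [if_pos hk]
          linarith
        · rw [if_neg hk, zero_add]
          exact (hK h k hk N).trans (le_abs_self _)
      refine (norm_sum_le_of_le _ hc).trans (le_of_eq ?_)
      rw [Finset.sum_add_distrib, Finset.sum_ite_eq, if_pos hh]
    refine (norm_sum_le_of_le _ hb).trans (le_of_eq ?_)
    simp [Finset.sum_add_distrib]
  have hT2 : ‖T‖ ^ 2 ≤ N * ∑ m ∈ Finset.range N, ‖∑ h ∈ Finset.range H, f (m + h)‖ ^ 2 := by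
    have h1 : ‖T‖ ≤ ∑ m ∈ Finset.range N, ‖∑ h ∈ Finset.range H, f (m + h)‖ := norm_sum_le _ _
    have h2 := sq_sum_le_card_mul_sum_sq (s := Finset.range N)
      (f := fun m => ‖∑ h ∈ Finset.range H, f (m + h)‖)
    rw [Finset.card_range] at h2
    exact (pow_le_pow_left₀ (norm_nonneg _) h1 2).trans h2
  have hT3 := hT2.trans (mul_le_mul_of_nonneg_left hQ (Nat.cast_nonneg N))
  have htri : H * ‖S‖ ≤ ‖T‖ + 2 * (H : ℝ) ^ 2 := by
    have := norm_sub_le T (T - H * S)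
    rw [sub_sub_cancel, norm_mul, Complex.norm_natCast] at this
    linarith
  calc _ ≤ (‖T‖ + 2 * (H : ℝ) ^ 2) ^ 2 := pow_le_pow_left₀ (by positivity) htri 2
    _ ≤ 8 * (H : ℝ) ^ 4 + 2 * ‖T‖ ^ 2 := by nlinarith [sq_nonneg (‖T‖ - 2 * (H : ℝ) ^ 2)]
    _ ≤ _ := by linarith

/-- If all nontrivial autocorrelation sums are bounded, the sequence has mean value zero. -/
theorem tendsto_mean_zero_of_autocorrelation (f : ℕ → ℂ) (hf : ∀ m, ‖f m‖ ≤ 1) (K : ℕ → ℕ → ℝ)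
    (hK : ∀ h k, h ≠ k → ∀ N,
      ‖∑ m ∈ Finset.range N, f (m + h) * (starRingEnd ℂ) (f (m + k))‖ ≤ K h k) :
    Tendsto (fun N : ℕ => (1 / (N : ℂ)) * ∑ m ∈ Finset.range N, f m) atTop (nhds 0) := by
  have hsq : Tendsto (fun N : ℕ => ‖(1 / (N : ℂ)) * ∑ m ∈ Finset.range N, f m‖ ^ 2)
      atTop (nhds 0) := by
    rw [Metric.tendsto_nhds]
    intro ε hε
    obtain ⟨H, hH⟩ := exists_nat_gt (2 / ε)
    have hH0 : (0 : ℝ) < H := lt_trans (by positivity) hH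
    set C := ∑ h ∈ Finset.range H, ∑ k ∈ Finset.range H, |K h k|
    have hi : Tendsto (fun N : ℕ => ((N : ℝ))⁻¹) atTop (nhds 0) :=
      tendsto_inv_atTop_nhds_zero_nat
    have hlim : Tendsto (fun N : ℕ => 8 * (H : ℝ) ^ 2 * ((N : ℝ)⁻¹) ^ 2 + 2 / (H : ℝ)
        + 2 * C / (H : ℝ) ^ 2 * (N : ℝ)⁻¹) atTop (nhds (2 / (H : ℝ))) := by
      have := (((hi.pow 2).const_mul (8 * (H : ℝ) ^ 2)).add_const (2 / (H : ℝ))).add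
        (hi.const_mul (2 * C / (H : ℝ) ^ 2))
      simpa using this
    have hlt : 2 / (H : ℝ) < ε := by
      rw [div_lt_iff₀ hε] at hH
      rw [div_lt_iff₀ hH0]
      linarith
    filter_upwards [hlim.eventually_lt_const hlt, eventually_gt_atTop 0] with N hN hN0
    have hN0' : (0 : ℝ) < N := by exact_mod_cast hN0
    rw [Real.dist_eq, sub_zero, abs_of_nonneg (sq_nonneg _)]
    refine lt_of_le_of_lt ?_ hN
    have := sq_norm_sum_range_le f hf K hK H N
    rw [norm_mul, norm_div, norm_one, Complex.norm_natCast]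
    refine le_of_mul_le_mul_left (a := ((H : ℝ) * N) ^ 2) ?_ (by positivity)
    calc _ = (H * ‖∑ m ∈ Finset.range N, f m‖) ^ 2 := by field_simp
      _ ≤ _ := this
      _ = _ := by field_simp; ring
  have := hsq.sqrt
  simp only [Real.sqrt_sq (norm_nonneg _), Real.sqrt_zero] at this
  exact tendsto_zero_iff_norm_tendsto_zero.2 this

theorem tendsto_mean_zero_of_bounded (f : ℕ → ℂ) (B : ℝ)
    (hB : ∀ N, ‖∑ m ∈ Finset.range N, f m‖ ≤ B) :
    Tendsto (fun N : ℕ => (1 / (N : ℂ)) * ∑ m ∈ Finset.range N, f m) atTop (nhds 0) := by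
  refine squeeze_zero_norm (a := fun N : ℕ => B * (N : ℝ)⁻¹) (fun N => ?_) ?_
  · rw [norm_mul, norm_div, norm_one, Complex.norm_natCast, one_div, mul_comm]
    exact mul_le_mul_of_nonneg_right (hB N) (by positivity)
  · simpa using (tendsto_inv_atTop_nhds_zero_nat (𝕜 := ℝ)).const_mul B

/-- The mean of a chirp `exp (2 i (a m + b m²))` vanishes unless both `a / π` and `b / π` are
rational. -/
theorem tendsto_mean_chirp_zero (a b : ℝ)
    (hab : ¬ (a ∈ Set.range (fun r : ℚ => (r : ℝ) * π) ∧
      b ∈ Set.range (fun r : ℚ => (r : ℝ) * π))) :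
    Tendsto (fun N : ℕ => (1 / (N : ℂ)) * ∑ m ∈ Finset.Icc 1 N,
      Complex.exp ((2 * (a * (m : ℝ) + b * (m : ℝ) ^ 2) : ℝ) * Complex.I)) atTop (nhds 0) := by
  have hexp : ∀ x : ℝ, x ∉ Set.range (fun r : ℚ => (r : ℝ) * π) → ∀ k : ℤ, k ≠ 0 →
      Complex.exp ((k * x : ℝ) * Complex.I) ≠ 1 := by
    intro x hx k hk h
    obtain ⟨n, hn⟩ := Complex.exp_eq_one_iff.1 h
    apply hx
    refine ⟨2 * n / k, ?_⟩
    have hk' : (k : ℝ) ≠ 0 := by exact_mod_cast hk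
    have h2 : (k : ℝ) * x = n * (2 * π) := by
      have h3 := congrArg Complex.im hn
      simpa using h3
    push_cast
    field_simp
    linarith
  have hsum : ∀ (g : ℕ → ℂ) N, ∑ m ∈ Finset.Icc 1 N, g m
      = ∑ m ∈ Finset.range N, g (m + 1) := by
    intro g N
    rw [Finset.range_eq_Ico, Finset.sum_Ico_add' g 0 N 1]
    rfl
  simp only [hsum]
  set f : ℕ → ℂ := fun m => Complex.exp
    ((2 * (a * ((m + 1 : ℕ) : ℝ) + b * ((m + 1 : ℕ) : ℝ) ^ 2) : ℝ) * Complex.I) with hfdef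
  have hf : ∀ m, ‖f m‖ ≤ 1 := fun m => (Complex.norm_exp_ofReal_mul_I _).le
  change Tendsto (fun N : ℕ => (1 / (N : ℂ)) * ∑ m ∈ Finset.range N, f m) atTop (nhds 0)
  by_cases hb : b ∈ Set.range (fun r : ℚ => (r : ℝ) * π)
  · have ha : a ∉ Set.range (fun r : ℚ => (r : ℝ) * π) := fun ha => hab ⟨ha, hb⟩
    obtain ⟨r, rfl⟩ := hb
    refine tendsto_mean_zero_of_bounded f _ (norm_sum_range_le_of_shift_eq_mul f hf r.den
      (Complex.exp (((2 * r.den : ℤ) * a : ℝ) * Complex.I))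
      (hexp a ha _ (by simp)) fun m => ?_)
    simp only [hfdef, ← Complex.exp_add]
    rw [Complex.exp_eq_exp_iff_exists_int]
    refine ⟨r.num * (2 * (m + 1) + r.den), ?_⟩
    have hr : (r : ℝ) * r.den = r.num := by exact_mod_cast Rat.mul_den_eq_num r
    have hr' : ((r : ℝ) : ℂ) * r.den = r.num := by exact_mod_cast hr
    push_cast at hr' ⊢
    linear_combination (2 * π * Complex.I * (2 * (m + 1) + r.den)) * hr'
  · refine tendsto_mean_zero_of_autocorrelation f hf
      (fun h k => 2 * (1 : ℕ) /
        ‖Complex.exp (((4 * ((h : ℤ) - k) : ℤ) * b : ℝ) * Complex.I) - 1‖) ?_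
    intro h k hhk N
    refine norm_sum_range_le_of_shift_eq_mul
      (fun m => f (m + h) * (starRingEnd ℂ) (f (m + k))) (fun m => ?_) 1 _
      (hexp b hb _ (by omega)) (fun m => ?_) N
    · rw [norm_mul, RCLike.norm_conj]
      exact mul_le_one₀ (hf _) (norm_nonneg _) (hf _)
    · simp only [hfdef, ← Complex.exp_conj, ← Complex.exp_add, map_mul, Complex.conj_ofReal,
        Complex.conj_I]
      congr 1
      push_cast
      ring

theorem norm_mean_chirp_le_one (a b : ℝ) (N : ℕ) : ‖(1 / (N : ℂ)) * ∑ m ∈ Finset.Icc 1 N,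
      Complex.exp ((2 * (a * (m : ℝ) + b * (m : ℝ) ^ 2) : ℝ) * Complex.I)‖ ≤ 1 := by
  have h := norm_sum_le_of_le (Finset.Icc 1 N) (n := fun _ => (1 : ℝ))
    (f := fun m : ℕ => Complex.exp ((2 * (a * (m : ℝ) + b * (m : ℝ) ^ 2) : ℝ) * Complex.I))
    (fun m _ => (Complex.norm_exp_ofReal_mul_I _).le)
  rw [norm_mul, norm_div, norm_one, Complex.norm_natCast, one_div, inv_mul_eq_div]
  refine div_le_one_of_le₀ (h.trans ?_) (Nat.cast_nonneg N)
  simp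

/-- The mean of the two-dimensional chirp vanishes unless all four parameters are rational
multiples of `π`. -/
theorem tendsto_mean_double_chirp_zero (α β γ δ : ℝ)
    (hC : ¬ ((α ∈ Set.range (fun r : ℚ => (r : ℝ) * π) ∧
      β ∈ Set.range (fun r : ℚ => (r : ℝ) * π)) ∧ (γ ∈ Set.range (fun r : ℚ => (r : ℝ) * π) ∧
      δ ∈ Set.range (fun r : ℚ => (r : ℝ) * π)))) :
    Tendsto (fun MN : ℕ × ℕ => (1 / ((MN.1 : ℂ) * MN.2)) *
      ∑ n ∈ Finset.Icc 1 MN.2, ∑ m ∈ Finset.Icc 1 MN.1, Complex.exp ((2 *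
        (α * (m : ℝ) + β * (m : ℝ) ^ 2 + γ * (n : ℝ) + δ * (n : ℝ) ^ 2) : ℝ) * Complex.I))
      atTop (nhds 0) := by
  set A : ℝ → ℝ → ℕ → ℂ := fun a b N => (1 / (N : ℂ)) * ∑ m ∈ Finset.Icc 1 N,
      Complex.exp ((2 * (a * (m : ℝ) + b * (m : ℝ) ^ 2) : ℝ) * Complex.I) with hA
  have hprod : ∀ MN : ℕ × ℕ, (1 / ((MN.1 : ℂ) * MN.2)) *
      ∑ n ∈ Finset.Icc 1 MN.2, ∑ m ∈ Finset.Icc 1 MN.1, Complex.exp ((2 *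
        (α * (m : ℝ) + β * (m : ℝ) ^ 2 + γ * (n : ℝ) + δ * (n : ℝ) ^ 2) : ℝ) * Complex.I)
      = A α β MN.1 * A γ δ MN.2 := by
    intro MN
    have : ∀ m n : ℕ, Complex.exp ((2 *
        (α * (m : ℝ) + β * (m : ℝ) ^ 2 + γ * (n : ℝ) + δ * (n : ℝ) ^ 2) : ℝ) * Complex.I)
        = Complex.exp ((2 * (γ * (n : ℝ) + δ * (n : ℝ) ^ 2) : ℝ) * Complex.I) *
          Complex.exp ((2 * (α * (m : ℝ) + β * (m : ℝ) ^ 2) : ℝ) * Complex.I) := by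
      intro m n
      rw [← Complex.exp_add]
      congr 1
      push_cast
      ring
    simp only [this, ← Finset.sum_mul_sum, hA]
    rw [one_div, mul_inv]
    ring
  simp only [hprod]
  rw [← prod_atTop_atTop_eq]
  by_cases h1 : α ∈ Set.range (fun r : ℚ => (r : ℝ) * π) ∧
      β ∈ Set.range (fun r : ℚ => (r : ℝ) * π)
  · have h2 := (tendsto_mean_chirp_zero γ δ fun h2 => hC ⟨h1, h2⟩).norm
    rw [norm_zero] at h2
    refine squeeze_zero_norm (fun MN => ?_) (h2.comp tendsto_snd)
    rw [norm_mul]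
    exact mul_le_of_le_one_left (norm_nonneg _) (norm_mean_chirp_le_one _ _ _)
  · have h2 := (tendsto_mean_chirp_zero α β h1).norm
    rw [norm_zero] at h2
    refine squeeze_zero_norm (fun MN => ?_) (h2.comp tendsto_fst)
    rw [norm_mul]
    exact mul_le_of_le_one_right (norm_nonneg _) (norm_mean_chirp_le_one _ _ _)

/-- There exists a countable subset `C` of `(0,π)⁴` such that for every
`ϑ = (α,β,γ,δ) ∈ (0,π)⁴` outside `C`, the 2×2 matrix `(1/(MN)) W(ϑ)ᵀW(ϑ)` (whose
entries are the normalized double sums of `cos²`, `cos·sin` and `sin²` of the chirp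
phase) converges to `[[1/2, 0], [0, 1/2]]` as `min{M,N} → ∞`; equivalently the three
normalized double sums converge to `1/2`, `1/2` and `0` respectively. -/
theorem stmt9 :
    ∃ C : Set (ℝ × ℝ × ℝ × ℝ), C.Countable ∧
      ∀ α β γ δ : ℝ, α ∈ Set.Ioo 0 π → β ∈ Set.Ioo 0 π →
        γ ∈ Set.Ioo 0 π → δ ∈ Set.Ioo 0 π → (α, β, γ, δ) ∉ C →
        (Tendsto (fun MN : ℕ × ℕ =>
            (1 / ((MN.1 : ℝ) * MN.2)) •
              (!![∑ n ∈ Finset.Icc 1 MN.2, ∑ m ∈ Finset.Icc 1 MN.1,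
                    Real.cos (α * (m : ℝ) + β * (m : ℝ) ^ 2 + γ * (n : ℝ) + δ * (n : ℝ) ^ 2) ^ 2,
                  ∑ n ∈ Finset.Icc 1 MN.2, ∑ m ∈ Finset.Icc 1 MN.1,
                    Real.cos (α * (m : ℝ) + β * (m : ℝ) ^ 2 + γ * (n : ℝ) + δ * (n : ℝ) ^ 2) *
                      Real.sin (α * (m : ℝ) + β * (m : ℝ) ^ 2 + γ * (n : ℝ) + δ * (n : ℝ) ^ 2);
                  ∑ n ∈ Finset.Icc 1 MN.2, ∑ m ∈ Finset.Icc 1 MN.1,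
                    Real.cos (α * (m : ℝ) + β * (m : ℝ) ^ 2 + γ * (n : ℝ) + δ * (n : ℝ) ^ 2) *
                      Real.sin (α * (m : ℝ) + β * (m : ℝ) ^ 2 + γ * (n : ℝ) + δ * (n : ℝ) ^ 2),
                  ∑ n ∈ Finset.Icc 1 MN.2, ∑ m ∈ Finset.Icc 1 MN.1,
                    Real.sin (α * (m : ℝ) + β * (m : ℝ) ^ 2 + γ * (n : ℝ) + δ * (n : ℝ) ^ 2) ^ 2] :
                Matrix (Fin 2) (Fin 2) ℝ))
          atTop (nhds !![(1 : ℝ) / 2, 0; 0, 1 / 2])) ∧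
        Tendsto (fun MN : ℕ × ℕ =>
            (1 / ((MN.1 : ℝ) * MN.2)) *
              ∑ n ∈ Finset.Icc 1 MN.2, ∑ m ∈ Finset.Icc 1 MN.1,
                Real.cos (α * (m : ℝ) + β * (m : ℝ) ^ 2 + γ * (n : ℝ) + δ * (n : ℝ) ^ 2) ^ 2)
          atTop (nhds (1 / 2)) ∧
        Tendsto (fun MN : ℕ × ℕ =>
            (1 / ((MN.1 : ℝ) * MN.2)) *
              ∑ n ∈ Finset.Icc 1 MN.2, ∑ m ∈ Finset.Icc 1 MN.1,
                Real.sin (α * (m : ℝ) + β * (m : ℝ) ^ 2 + γ * (n : ℝ) + δ * (n : ℝ) ^ 2) ^ 2)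
          atTop (nhds (1 / 2)) ∧
        Tendsto (fun MN : ℕ × ℕ =>
            (1 / ((MN.1 : ℝ) * MN.2)) *
              ∑ n ∈ Finset.Icc 1 MN.2, ∑ m ∈ Finset.Icc 1 MN.1,
                Real.cos (α * (m : ℝ) + β * (m : ℝ) ^ 2 + γ * (n : ℝ) + δ * (n : ℝ) ^ 2) *
                  Real.sin (α * (m : ℝ) + β * (m : ℝ) ^ 2 + γ * (n : ℝ) + δ * (n : ℝ) ^ 2))
          atTop (nhds 0) := by
  set R : Set ℝ := Set.range (fun r : ℚ => (r : ℝ) * π) with hR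
  have hRc : R.Countable := Set.countable_range _
  refine ⟨R ×ˢ R ×ˢ R ×ˢ R, hRc.prod (hRc.prod (hRc.prod hRc)), ?_⟩
  intro α β γ δ _ _ _ _ hC
  have hE := tendsto_mean_double_chirp_zero α β γ δ
    (fun h => hC ⟨h.1.1, h.1.2, h.2.1, h.2.2⟩)
  set p : ℕ → ℕ → ℝ := fun m n =>
    α * (m : ℝ) + β * (m : ℝ) ^ 2 + γ * (n : ℝ) + δ * (n : ℝ) ^ 2 with hp
  have hcast : ∀ MN : ℕ × ℕ, (1 / ((MN.1 : ℂ) * MN.2)) =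
      ((1 / ((MN.1 : ℝ) * MN.2) : ℝ) : ℂ) := fun MN => by push_cast; rfl
  have hre : Tendsto (fun MN : ℕ × ℕ => (1 / ((MN.1 : ℝ) * MN.2)) *
      ∑ n ∈ Finset.Icc 1 MN.2, ∑ m ∈ Finset.Icc 1 MN.1, Real.cos (2 * p m n))
      atTop (nhds 0) := by
    have := (Complex.continuous_re.tendsto 0).comp hE
    simpa only [Function.comp_def, hcast, Complex.re_ofReal_mul, Complex.re_sum,
      Complex.exp_ofReal_mul_I_re, Complex.zero_re] using this
  have him : Tendsto (fun MN : ℕ × ℕ => (1 / ((MN.1 : ℝ) * MN.2)) *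
      ∑ n ∈ Finset.Icc 1 MN.2, ∑ m ∈ Finset.Icc 1 MN.1, Real.sin (2 * p m n))
      atTop (nhds 0) := by
    have := (Complex.continuous_im.tendsto 0).comp hE
    simpa only [Function.comp_def, hcast, Complex.im_ofReal_mul, Complex.im_sum,
      Complex.exp_ofReal_mul_I_im, Complex.zero_im] using this
  have hpos : ∀ᶠ MN : ℕ × ℕ in atTop, 0 < MN.1 ∧ 0 < MN.2 := by
    filter_upwards [eventually_ge_atTop ((1, 1) : ℕ × ℕ)] with MN h
    exact ⟨h.1, h.2⟩
  have hcos : Tendsto (fun MN : ℕ × ℕ => (1 / ((MN.1 : ℝ) * MN.2)) *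
      ∑ n ∈ Finset.Icc 1 MN.2, ∑ m ∈ Finset.Icc 1 MN.1, Real.cos (p m n) ^ 2)
      atTop (nhds (1 / 2)) := by
    have h := (hre.div_const 2).const_add (1 / 2)
    rw [zero_div, add_zero] at h
    refine h.congr' ?_
    filter_upwards [hpos] with MN hMN
    have h1 : (MN.1 : ℝ) ≠ 0 := by exact_mod_cast hMN.1.ne'
    have h2 : (MN.2 : ℝ) ≠ 0 := by exact_mod_cast hMN.2.ne'
    simp only [Real.cos_sq, Finset.sum_add_distrib, ← Finset.sum_div, Finset.sum_const,
      Nat.card_Icc, nsmul_eq_mul, Nat.add_sub_cancel]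
    field_simp
  have hsin : Tendsto (fun MN : ℕ × ℕ => (1 / ((MN.1 : ℝ) * MN.2)) *
      ∑ n ∈ Finset.Icc 1 MN.2, ∑ m ∈ Finset.Icc 1 MN.1, Real.sin (p m n) ^ 2)
      atTop (nhds (1 / 2)) := by
    have h := hcos.const_sub 1
    norm_num only at h
    norm_num only
    refine h.congr' ?_
    filter_upwards [hpos] with MN hMN
    have h1 : (MN.1 : ℝ) ≠ 0 := by exact_mod_cast hMN.1.ne'
    have h2 : (MN.2 : ℝ) ≠ 0 := by exact_mod_cast hMN.2.ne'
    simp only [Real.sin_sq, Finset.sum_sub_distrib, Finset.sum_const,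
      Nat.card_Icc, nsmul_eq_mul, Nat.add_sub_cancel]
    field_simp
  have hcs : Tendsto (fun MN : ℕ × ℕ => (1 / ((MN.1 : ℝ) * MN.2)) *
      ∑ n ∈ Finset.Icc 1 MN.2, ∑ m ∈ Finset.Icc 1 MN.1, Real.cos (p m n) * Real.sin (p m n))
      atTop (nhds 0) := by
    have h := him.div_const 2
    rw [zero_div] at h
    refine h.congr fun MN => ?_
    rw [mul_div_assoc]
    congr 1
    simp only [Finset.sum_div, Real.sin_two_mul]
    exact Finset.sum_congr rfl fun n _ => Finset.sum_congr rfl fun m _ => by ring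
  refine ⟨?_, hcos, hsin, hcs⟩
  refine tendsto_pi_nhds.2 fun i => tendsto_pi_nhds.2 fun j => ?_
  fin_cases i <;> fin_cases j
  · exact hcos
  · exact hcs
  · exact hcs
  · exact hsin
end
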